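/- Let X be a Banach space over 𝕂 (where 𝕂 = ℝ or 𝕂 = ℂ), and let 𝒜 be a norm-closed subalgebra of the algebra L(X) of bounded linear operators on X. If there exists a halfspace Y of X which is almost-invariant under every A ∈ 𝒜, then there exists a halfspace Z of X which is invariant under every A ∈ 𝒜, i.e. AZ ⊆ Z for all A ∈ 𝒜. -/

import Mathlib

/-- A halfspace of a Banach space `X` over `𝕜` (`𝕜 = ℝ` or `ℂ`): a closed subspace
of infinite dimension and infinite codimension. -/
def IsHalfspace {𝕜 X : Type*} [RCLike 𝕜] [NormedAddCommGroup X] [NormedSpace 𝕜 X]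
    (Y : Submodule 𝕜 X) : Prop :=
  IsClosed (Y : Set X) ∧ ¬FiniteDimensional 𝕜 Y ∧ ¬FiniteDimensional 𝕜 (X ⧸ Y)

open Filter Topology in
/-- If the family `T ∘ y` is linearly independent and no nearby perturbation `T + t • S` admits a
larger independent family of values, then `S` maps the kernel of `T` into the span of `T ∘ y`. -/
theorem mem_span_range_of_eventually_not_linearIndependent {𝕜 V W : Type*}
    [NontriviallyNormedField 𝕜] [CompleteSpace 𝕜] [AddCommGroup V] [Module 𝕜 V]
    [NormedAddCommGroup W] [NormedSpace 𝕜 W] (T S : V →ₗ[𝕜] W) {m : ℕ} (y : Fin m → V)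
    (hy : LinearIndependent 𝕜 (fun i => T (y i)))
    (h : ∀ᶠ t in 𝓝 (0 : 𝕜), ∀ z : Fin (m + 1) → V,
      ¬LinearIndependent 𝕜 (fun i => (T + t • S) (z i)))
    {x : V} (hx : T x = 0) : S x ∈ Submodule.span 𝕜 (Set.range fun i => T (y i)) := by
  by_contra hSx
  let f : 𝕜 → Fin (m + 1) → W := fun t => Fin.cons (S x) (fun i => (T + t • S) (y i))
  have hf : Continuous f := by
    refine continuous_pi fun i => ?_
    refine Fin.cases ?_ (fun i => ?_) i
    · simpa [f] using continuous_const
    · simp only [f, Fin.cons_succ, LinearMap.add_apply, LinearMap.smul_apply]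
      fun_prop
  have hf0 : LinearIndependent 𝕜 (f 0) := by
    simpa [f, linearIndependent_finCons] using ⟨hy, hSx⟩
  have hind : ∀ᶠ t in 𝓝 (0 : 𝕜), LinearIndependent 𝕜 (f t) :=
    hf.continuousAt.eventually (hf0.eventually)
  obtain ⟨t, ⟨ht, hn⟩, ht0⟩ :=
    (((hind.and h).filter_mono nhdsWithin_le_nhds).and
      (self_mem_nhdsWithin : {(0 : 𝕜)}ᶜ ∈ 𝓝[≠] (0 : 𝕜))).exists
  refine hn (Fin.cons x y) ?_
  let w : Fin (m + 1) → 𝕜ˣ := Fin.cons (Units.mk0 t ht0) 1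
  convert ht.units_smul w using 1
  funext i
  refine Fin.cases ?_ (fun i => ?_) i
  · simp only [f, w, Fin.cons_zero, Pi.smul_apply', LinearMap.add_apply, LinearMap.smul_apply, hx,
      zero_add]
    rfl
  · simp [f, w]

/-- A space is finite-dimensional if a linear map out of it has finite-dimensional kernel and takes
values in a finite-dimensional subspace. -/
theorem finiteDimensional_of_ker_of_forall_mem {𝕜 V W : Type*} [Field 𝕜] [AddCommGroup V]
    [Module 𝕜 V] [AddCommGroup W] [Module 𝕜 W] (T : V →ₗ[𝕜] W) (G : Submodule 𝕜 W)
    [FiniteDimensional 𝕜 G] (hT : ∀ v, T v ∈ G) [FiniteDimensional 𝕜 (LinearMap.ker T)] :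
    FiniteDimensional 𝕜 V := by
  have hle : LinearMap.range T ≤ G := by
    rintro _ ⟨v, rfl⟩
    exact hT v
  have : FiniteDimensional 𝕜 (LinearMap.range T) := Submodule.finiteDimensional_of_le hle
  have : FiniteDimensional 𝕜 (V ⧸ LinearMap.ker T) :=
    Module.Finite.equiv T.quotKerEquivRange.symm
  exact Module.Finite.of_submodule_quotient (LinearMap.ker T)

/-- Adding a finite-dimensional subspace to a subspace of infinite codimension leaves the codimension
infinite. -/
theorem not_finiteDimensional_quotient_sup {𝕜 X : Type*} [Field 𝕜] [AddCommGroup X] [Module 𝕜 X]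
    {Y : Submodule 𝕜 X} (hY : ¬FiniteDimensional 𝕜 (X ⧸ Y)) (F : Submodule 𝕜 X)
    [FiniteDimensional 𝕜 F] : ¬FiniteDimensional 𝕜 (X ⧸ (Y ⊔ F)) := by
  intro h
  refine hY ?_
  have : FiniteDimensional 𝕜 ((X ⧸ Y) ⧸ (Y ⊔ F).map Y.mkQ) :=
    Module.Finite.equiv (Submodule.quotientQuotientEquivQuotient Y (Y ⊔ F) le_sup_left).symm
  have : FiniteDimensional 𝕜 ((Y ⊔ F).map Y.mkQ) := by
    rw [Submodule.map_sup, Submodule.mkQ_map_self, bot_sup_eq]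
    infer_instance
  exact Module.Finite.of_submodule_quotient ((Y ⊔ F).map Y.mkQ)

open Filter Topology in
/-- A norm-closed subspace of operators with a common almost-invariant halfspace `Y` maps the part of
`Y` which some member sends into `Y` into a fixed finite-dimensional enlargement of `Y`. -/
theorem exists_forall_mem_sup_of_almostInvariant {𝕜 X : Type*} [RCLike 𝕜] [NormedAddCommGroup X]
    [NormedSpace 𝕜 X] [CompleteSpace X] (𝒜 : Submodule 𝕜 (X →L[𝕜] X))
    (h𝒜 : IsClosed (𝒜 : Set (X →L[𝕜] X))) (Y : Submodule 𝕜 X) (hY : IsClosed (Y : Set X))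
    (h : ∀ A ∈ 𝒜, ∃ E : Submodule 𝕜 X, FiniteDimensional 𝕜 E ∧ ∀ y ∈ Y, A y ∈ Y ⊔ E) :
    ∃ T ∈ 𝒜, ∃ F : Submodule 𝕜 X, FiniteDimensional 𝕜 F ∧
      ∀ S ∈ 𝒜, ∀ x ∈ Y, T x ∈ Y → S x ∈ Y ⊔ F := by
  have : IsClosed (Y : Set X) := hY
  have : CompleteSpace 𝒜 := h𝒜.completeSpace_coe
  let q : (X →L[𝕜] X) → Y →ₗ[𝕜] X ⧸ Y := fun A => Y.mkQ ∘ₗ (A : X →ₗ[𝕜] X) ∘ₗ Y.subtype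
  let R : ℕ → Set 𝒜 := fun n =>
    {A | ∀ z : Fin n → Y, ¬LinearIndependent 𝕜 (fun i => q A (z i))}
  have hR : ∀ n, IsClosed (R n) := by
    intro n
    simp only [R, Set.ofPred_forall]
    refine isClosed_iInter fun z => ?_
    rw [← isOpen_compl_iff]
    have hc : Continuous fun (A : 𝒜) (i : Fin n) => q A (z i) := by
      refine continuous_pi fun i => ?_
      have : Continuous fun A : 𝒜 => (A : X →L[𝕜] X) (z i) := by fun_prop
      exact Y.mkQL.continuous.comp this
    have := (isOpen_setOfPred_linearIndependent (𝕜 := 𝕜) (E := X ⧸ Y) (ι := Fin n)).preimage hc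
    simpa [Set.compl_ofPred] using this
  have hU : ⋃ n, R n = Set.univ := by
    refine Set.eq_univ_of_forall fun A => ?_
    obtain ⟨E, hE, hAE⟩ := h A A.2
    refine Set.mem_iUnion.2 ⟨Module.finrank 𝕜 (E.map Y.mkQ) + 1, fun z hz => ?_⟩
    have hmem : ∀ i, q A (z i) ∈ E.map Y.mkQ := by
      intro i
      have := Submodule.mem_map_of_mem (f := Y.mkQ) (hAE (z i) (z i).2)
      rwa [Submodule.map_sup, Submodule.mkQ_map_self, bot_sup_eq] at this
    have hli : LinearIndependent 𝕜 fun i => (⟨q A (z i), hmem i⟩ : E.map Y.mkQ) :=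
      LinearIndependent.of_comp (E.map Y.mkQ).subtype hz
    have := hli.fintype_card_le_finrank
    simp at this
  have hex : ∃ n, (interior (R n)).Nonempty := nonempty_interior_of_iUnion_of_closed hR hU
  classical
  obtain ⟨m, hm⟩ : ∃ m, Nat.find hex = m + 1 := by
    refine Nat.exists_eq_succ_of_ne_zero fun h0 => ?_
    obtain ⟨A, hA⟩ := h0 ▸ Nat.find_spec hex
    exact interior_subset hA Fin.elim0 linearIndependent_empty_type
  have hint : (interior (R (m + 1))).Nonempty := hm ▸ Nat.find_spec hex
  have hmin : ¬(interior (R m)).Nonempty := Nat.find_min hex (by omega)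
  obtain ⟨T, hT, hTm⟩ : ∃ T ∈ interior (R (m + 1)), T ∉ R m := by
    by_contra! hsub
    exact hmin (hint.mono (interior_maximal hsub isOpen_interior))
  obtain ⟨y, hy⟩ : ∃ y : Fin m → Y, LinearIndependent 𝕜 (fun i => q T (y i)) := by
    simpa [R] using hTm
  refine ⟨T, T.2, Submodule.span 𝕜 (Set.range fun i => (T : X →L[𝕜] X) (y i)),
    FiniteDimensional.span_of_finite 𝕜 (Set.finite_range _), fun S hS x hx hTx => ?_⟩
  have hev : ∀ᶠ t in 𝓝 (0 : 𝕜), T + t • (⟨S, hS⟩ : 𝒜) ∈ R (m + 1) := by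
    have hc : Continuous fun t : 𝕜 => T + t • (⟨S, hS⟩ : 𝒜) := by fun_prop
    refine hc.continuousAt.eventually ?_
    simpa using mem_interior_iff_mem_nhds.1 hT
  have key := mem_span_range_of_eventually_not_linearIndependent (q T) (q S) y hy
    (hev.mono fun t ht z => ht z) (x := ⟨x, hx⟩) ((Submodule.Quotient.mk_eq_zero Y).2 hTx)
  have hspan : Submodule.span 𝕜 (Set.range fun i => q T (y i)) =
      (Submodule.span 𝕜 (Set.range fun i => (T : X →L[𝕜] X) (y i))).map Y.mkQ := by
    rw [Submodule.map_span, ← Set.range_comp]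
    rfl
  rw [hspan] at key
  rw [← Submodule.comap_map_mkQ]
  exact key

/-- If a norm-closed subalgebra `𝒜` of `L(X)` has a common almost-invariant halfspace,
then it has a common invariant halfspace. -/
theorem common_ihs_of_common_aihs
    {𝕜 X : Type*} [RCLike 𝕜] [NormedAddCommGroup X] [NormedSpace 𝕜 X] [CompleteSpace X]
    (𝒜 : Subalgebra 𝕜 (X →L[𝕜] X)) (h𝒜 : IsClosed (𝒜 : Set (X →L[𝕜] X)))
    (hY : ∃ Y : Submodule 𝕜 X, IsHalfspace Y ∧
      ∀ A ∈ 𝒜, ∃ E : Submodule 𝕜 X, FiniteDimensional 𝕜 E ∧ ∀ y ∈ Y, A y ∈ Y ⊔ E) :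
    ∃ Z : Submodule 𝕜 X, IsHalfspace Z ∧ ∀ A ∈ 𝒜, ∀ z ∈ Z, A z ∈ Z := by
  obtain ⟨Y, ⟨hYc, hYd, hYq⟩, hYA⟩ := hY
  obtain ⟨T, hT, F, hF, hTF⟩ :=
    exists_forall_mem_sup_of_almostInvariant (Subalgebra.toSubmodule 𝒜) h𝒜 Y hYc hYA
  let Z : Submodule 𝕜 X := ⨅ A : 𝒜, (Y ⊔ F).comap ((A : X →L[𝕜] X) : X →ₗ[𝕜] X)
  have hZ : ∀ x, x ∈ Z ↔ ∀ A ∈ 𝒜, A x ∈ Y ⊔ F := by simp [Z]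
  refine ⟨Z, ⟨?_, fun hfin => hYd ?_, fun hfin => ?_⟩, fun A hA z hz => ?_⟩
  · have hcl : IsClosed ((Y ⊔ F : Submodule 𝕜 X) : Set X) :=
      Submodule.isClosed_sup_finiteDimensional Y F hYc
    simp only [Z, Submodule.coe_iInf]
    exact isClosed_iInter fun A => hcl.preimage (A : X →L[𝕜] X).continuous
  · obtain ⟨E, hE, hTE⟩ := hYA T hT
    let g : Y →ₗ[𝕜] X ⧸ Y := Y.mkQ ∘ₗ (T : X →ₗ[𝕜] X) ∘ₗ Y.subtype
    have hker : ∀ v : LinearMap.ker g, (v : X) ∈ Z := fun v =>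
      (hZ _).2 fun A hA => hTF A hA _ v.1.2 ((Submodule.Quotient.mk_eq_zero Y).1 v.2)
    have : FiniteDimensional 𝕜 (LinearMap.ker g) :=
      Module.Finite.of_injective
        ((Y.subtype ∘ₗ (LinearMap.ker g).subtype).codRestrict Z hker) fun a b hab =>
          Subtype.ext (Subtype.ext (congrArg (Subtype.val : Z → X) hab))
    refine finiteDimensional_of_ker_of_forall_mem g (E.map Y.mkQ) fun v => ?_
    have := Submodule.mem_map_of_mem (f := Y.mkQ) (hTE v v.2)
    rwa [Submodule.map_sup, Submodule.mkQ_map_self, bot_sup_eq] at this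
  · have hle : Z ≤ Y ⊔ F := fun x hx => (hZ x).1 hx 1 (one_mem 𝒜)
    exact not_finiteDimensional_quotient_sup hYq F
      (Module.Finite.of_surjective _ (Submodule.factor_surjective hle))
  · exact (hZ _).2 fun B hB => (hZ z).1 hz (B * A) (mul_mem hB hA)
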